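/- arXiv:math-ph/0210026 — 2 statements merged into one kernel-verified Lean document; each statement's English description precedes it below -/
import Mathlib

section
/- Let q = (q_1, …, q_k) : ℝⁿ × ℝⁿ → ℝᵏ be a smooth map whose components have pairwise vanishing Poisson brackets, and let Φ : ℝᵏ × (ℝⁿ × ℝⁿ) → ℝⁿ × ℝⁿ be a joint Hamiltonian flow of q. Let E₀ ∈ ℝᵏ be such that Σ₀ = q⁻¹(E₀) is nonempty, compact and connected, and the total derivative dq(ν) : ℝ²ⁿ → ℝᵏ is surjective at every ν ∈ Σ₀. Assume every point of Σ₀ is periodic with period lattice containing (2πℤ)ᵏ, i.e. Φ(T, ν) = ν for all T ∈ (2πℤ)ᵏ and all ν ∈ Σ₀. Then for every pair of points ν₀, ν₁ ∈ Σ₀ and every period T = (T₁, …, T_k) ∈ (2πℤ)ᵏ, the action of the loop s ∈ [0,1] ↦ Φ(sT, ν₁) equals the sum over j = 1, …, k of the actions of the loops s ∈ [0, T_j] ↦ Φ(s ε_j, ν₀), where (ε_j) is the standard basis of ℝᵏ. In particular the action of the loop s ↦ Φ(sT, ν) is independent of the base point ν ∈ Σ₀. -/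
noncomputable section

open Finset

/-- The Hamiltonian vector field of `f` on the phase space `T*ℝⁿ = ℝⁿ × ℝⁿ`:
`H_f(x, ξ) = (∂_ξ f, −∂_x f)`. -/
def hamVF {n : ℕ} (f : (Fin n → ℝ) × (Fin n → ℝ) → ℝ) :
    (Fin n → ℝ) × (Fin n → ℝ) → (Fin n → ℝ) × (Fin n → ℝ) :=
  fun ν => (fun j => fderiv ℝ f ν (0, Pi.single j 1),
            fun j => -fderiv ℝ f ν (Pi.single j 1, 0))

/-- The Poisson bracket `{f, g} = Σ_j (∂_{ξ_j} f ∂_{x_j} g − ∂_{x_j} f ∂_{ξ_j} g)`. -/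
def poisson {n : ℕ} (f g : (Fin n → ℝ) × (Fin n → ℝ) → ℝ) :
    (Fin n → ℝ) × (Fin n → ℝ) → ℝ :=
  fun ν => ∑ j : Fin n,
    (fderiv ℝ f ν (0, Pi.single j 1) * fderiv ℝ g ν (Pi.single j 1, 0) -
     fderiv ℝ f ν (Pi.single j 1, 0) * fderiv ℝ g ν (0, Pi.single j 1))

/-- `Φ : ℝᵏ × (ℝⁿ × ℝⁿ) → ℝⁿ × ℝⁿ` is a joint Hamiltonian flow of
`q = (q_1, …, q_k)`: it is smooth, `Φ(0, ν) = ν`, and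
`∂Φ/∂t_j(t, ν) = H_{q_j}(Φ(t, ν))` for all `j`, `t`, `ν`. -/
def IsJointFlow {n k : ℕ} (q : Fin k → (Fin n → ℝ) × (Fin n → ℝ) → ℝ)
    (Φ : (Fin k → ℝ) → (Fin n → ℝ) × (Fin n → ℝ) → (Fin n → ℝ) × (Fin n → ℝ)) : Prop :=
  ContDiff ℝ (⊤ : ℕ∞) (fun p : (Fin k → ℝ) × ((Fin n → ℝ) × (Fin n → ℝ)) => Φ p.1 p.2) ∧
  (∀ ν, Φ 0 ν = ν) ∧
  ∀ (j : Fin k) (t : Fin k → ℝ) ν,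
    fderiv ℝ (fun s => Φ s ν) t (Pi.single j 1) = hamVF (q j) (Φ t ν)

/-- The action `A(c) = ∫_a^b ⟨c_ξ(s), c_x′(s)⟩ ds` of the curve `c : [a,b] → ℝⁿ × ℝⁿ`. -/
def pathAction {n : ℕ} (a b : ℝ) (c : ℝ → (Fin n → ℝ) × (Fin n → ℝ)) : ℝ :=
  ∫ s in a..b, ∑ j : Fin n, (c s).2 j * deriv (fun u => (c u).1 j) s

section

open Topology

/-- The standard symplectic form on `T*ℝⁿ`. -/
def sympl {n : ℕ} (u v : (Fin n → ℝ) × (Fin n → ℝ)) : ℝ :=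
  ∑ j : Fin n, (u.2 j * v.1 j - u.1 j * v.2 j)

theorem sympl_sum_right {n : ℕ} {ι : Type*} (s : Finset ι) (u : (Fin n → ℝ) × (Fin n → ℝ))
    (v : ι → (Fin n → ℝ) × (Fin n → ℝ)) :
    sympl u (∑ i ∈ s, v i) = ∑ i ∈ s, sympl u (v i) := by
  simp only [sympl, Prod.fst_sum, Prod.snd_sum, Finset.sum_apply, Finset.mul_sum,
    ← Finset.sum_sub_distrib]
  exact Finset.sum_comm

theorem sympl_smul_right {n : ℕ} (c : ℝ) (u v : (Fin n → ℝ) × (Fin n → ℝ)) :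
    sympl u (c • v) = c * sympl u v := by
  simp only [sympl, Finset.mul_sum, Prod.smul_fst, Prod.smul_snd, Pi.smul_apply, smul_eq_mul]
  exact Finset.sum_congr rfl fun j _ => by ring

theorem sympl_swap {n : ℕ} (u v : (Fin n → ℝ) × (Fin n → ℝ)) : sympl u v = -sympl v u := by
  simp only [sympl, ← Finset.sum_neg_distrib]
  exact Finset.sum_congr rfl fun j _ => by ring

theorem sympl_hamVF {n : ℕ} (f : (Fin n → ℝ) × (Fin n → ℝ) → ℝ)
    (ν v : (Fin n → ℝ) × (Fin n → ℝ)) : sympl v (hamVF f ν) = fderiv ℝ f ν v := by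
  have hv : v = ∑ j, (v.1 j • ((Pi.single j 1, 0) : (Fin n → ℝ) × (Fin n → ℝ)) +
      v.2 j • ((0, Pi.single j 1) : (Fin n → ℝ) × (Fin n → ℝ))) := by
    ext i <;> simp [Prod.fst_sum, Prod.snd_sum, Finset.sum_apply, Pi.single_apply]
  conv_rhs => rw [hv]
  simp only [sympl, hamVF, map_sum, map_add, map_smul, smul_eq_mul]
  exact Finset.sum_congr rfl fun j _ => by ring

theorem sympl_hamVF_hamVF {n : ℕ} (f g : (Fin n → ℝ) × (Fin n → ℝ) → ℝ)
    (ν : (Fin n → ℝ) × (Fin n → ℝ)) : sympl (hamVF f ν) (hamVF g ν) = poisson f g ν := by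
  rw [sympl_swap]
  simp only [sympl, hamVF, poisson, ← Finset.sum_neg_distrib]
  exact Finset.sum_congr rfl fun j _ => by ring

theorem hasFDerivAt_mul_partial {a b : ℝ × ℝ → ℝ} {p : ℝ × ℝ} (ha : ContDiffAt ℝ 2 a p)
    (hb : ContDiffAt ℝ 2 b p) (e : ℝ × ℝ) :
    HasFDerivAt (fun z => a z * fderiv ℝ b z e)
      (a p • (fderiv ℝ (fderiv ℝ b) p).flip e + fderiv ℝ b p e • fderiv ℝ a p) p := by
  have h1 := (ha.differentiableAt (by norm_num)).hasFDerivAt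
  have h2 : HasFDerivAt (fderiv ℝ b) (fderiv ℝ (fderiv ℝ b) p) p :=
    ((hb.fderiv_right (m := 1) (by norm_num)).differentiableAt (by norm_num)).hasFDerivAt
  have h3 : HasFDerivAt (fun z => fderiv ℝ b z e) ((fderiv ℝ (fderiv ℝ b) p).flip e) p := by
    have := h2.clm_apply (hasFDerivAt_const e p)
    rwa [ContinuousLinearMap.comp_zero, zero_add] at this
  exact h1.mul h3

/-- Stokes' theorem for the canonical one-form on an isotropic square: the actions along opposite
sides differ by the same amount. -/
theorem pathAction_isotropic_square {n : ℕ} {C : ℝ × ℝ → (Fin n → ℝ) × (Fin n → ℝ)}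
    (hC : ∀ p ∈ Set.Icc (0 : ℝ) 1 ×ˢ Set.Icc (0 : ℝ) 1, ContDiffAt ℝ 2 C p)
    (hiso : ∀ p ∈ Set.Icc (0 : ℝ) 1 ×ˢ Set.Icc (0 : ℝ) 1,
      sympl (fderiv ℝ C p (1, 0)) (fderiv ℝ C p (0, 1)) = 0) :
    pathAction 0 1 (fun s => C (1, s)) - pathAction 0 1 (fun s => C (0, s)) =
      pathAction 0 1 (fun r => C (r, 1)) - pathAction 0 1 (fun r => C (r, 0)) := by
  have hx : ∀ j, ∀ p ∈ Set.Icc (0 : ℝ) 1 ×ˢ Set.Icc (0 : ℝ) 1,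
      ContDiffAt ℝ 2 (fun z => (C z).1 j) p :=
    fun j p hp => contDiffAt_pi.1 (hC p hp).fst j
  have hξ : ∀ j, ∀ p ∈ Set.Icc (0 : ℝ) 1 ×ˢ Set.Icc (0 : ℝ) 1,
      ContDiffAt ℝ 2 (fun z => (C z).2 j) p :=
    fun j p hp => contDiffAt_pi.1 (hC p hp).snd j
  have hdx : ∀ j, ∀ p ∈ Set.Icc (0 : ℝ) 1 ×ˢ Set.Icc (0 : ℝ) 1, ∀ e,
      fderiv ℝ (fun z => (C z).1 j) p e = (fderiv ℝ C p e).1 j := by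
    intro j p hp e
    have h := ((hC p hp).differentiableAt (by norm_num)).hasFDerivAt
    rw [(hasFDerivAt_pi'.1 h.fst j).fderiv]
    rfl
  have hdξ : ∀ j, ∀ p ∈ Set.Icc (0 : ℝ) 1 ×ˢ Set.Icc (0 : ℝ) 1, ∀ e,
      fderiv ℝ (fun z => (C z).2 j) p e = (fderiv ℝ C p e).2 j := by
    intro j p hp e
    have h := ((hC p hp).differentiableAt (by norm_num)).hasFDerivAt
    rw [(hasFDerivAt_pi'.1 h.snd j).fderiv]
    rfl
  set α : ℝ × ℝ → ℝ × ℝ → ℝ := fun e p => ∑ j, (C p).2 j * fderiv ℝ (fun z => (C z).1 j) p e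
  set α' : ℝ × ℝ → ℝ × ℝ → (ℝ × ℝ →L[ℝ] ℝ) := fun e p => ∑ j,
    ((C p).2 j • (fderiv ℝ (fderiv ℝ (fun z => (C z).1 j)) p).flip e +
      fderiv ℝ (fun z => (C z).1 j) p e • fderiv ℝ (fun z => (C z).2 j) p) with hα'
  have hderiv : ∀ e, ∀ p ∈ Set.Icc (0 : ℝ) 1 ×ˢ Set.Icc (0 : ℝ) 1, HasFDerivAt (α e) (α' e p) p :=
    fun e p hp => HasFDerivAt.fun_sum fun j _ =>
      hasFDerivAt_mul_partial (hξ j p hp) (hx j p hp) e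
  have hcurl : ∀ p ∈ Set.Icc (0 : ℝ) 1 ×ˢ Set.Icc (0 : ℝ) 1,
      α' (0, 1) p (1, 0) + (-α' (1, 0) p) (0, 1) = 0 := by
    intro p hp
    refine Eq.trans ?_ (hiso p hp)
    simp only [hα', sympl, _root_.neg_apply, _root_.sum_apply,
      _root_.add_apply, _root_.smul_apply,
      ContinuousLinearMap.flip_apply, smul_eq_mul, ← Finset.sum_neg_distrib,
      ← Finset.sum_add_distrib]
    refine Finset.sum_congr rfl fun j _ => ?_
    rw [(hx j p hp).isSymmSndFDerivAt (by simp) (1, 0) (0, 1), hdx j p hp, hdx j p hp,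
      hdξ j p hp, hdξ j p hp]
    ring
  have hbox : (Set.uIcc (0 : ℝ) 1 ×ˢ Set.uIcc (0 : ℝ) 1) =
      Set.Icc (0 : ℝ) 1 ×ˢ Set.Icc (0 : ℝ) 1 := by
    rw [Set.uIcc_of_le zero_le_one]
  have hsub : ∀ p ∈ Set.Ioo (min (0 : ℝ) 1) (max 0 1) ×ˢ Set.Ioo (min (0 : ℝ) 1) (max 0 1) \ ∅,
      p ∈ Set.Icc (0 : ℝ) 1 ×ˢ Set.Icc (0 : ℝ) 1 := by
    rintro p ⟨⟨h1, h2⟩, -⟩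
    simp only [min_eq_left (zero_le_one' ℝ), max_eq_right (zero_le_one' ℝ)] at h1 h2
    exact ⟨Set.Ioo_subset_Icc_self h1, Set.Ioo_subset_Icc_self h2⟩
  have key := MeasureTheory.integral2_divergence_prod_of_hasFDerivAt_off_countable
    (α (0, 1)) (fun p => -α (1, 0) p) (α' (0, 1)) (fun p => -α' (1, 0) p) 0 0 1 1 ∅
    Set.countable_empty
    (fun p hp => (hderiv _ p (hbox ▸ hp)).continuousAt.continuousWithinAt)
    (fun p hp => (hderiv _ p (hbox ▸ hp)).continuousAt.neg.continuousWithinAt)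
    (fun p hp => hderiv _ p (hsub p hp)) (fun p hp => (hderiv _ p (hsub p hp)).neg)
    (by
      rw [hbox]
      refine MeasureTheory.integrableOn_zero.congr_fun (fun p hp => (hcurl p hp).symm)
        (measurableSet_Icc.prod measurableSet_Icc))
  have hzero : (∫ x in (0 : ℝ)..1, ∫ y in (0 : ℝ)..1,
      α' (0, 1) (x, y) (1, 0) + (-α' (1, 0) (x, y)) (0, 1)) = 0 := by
    refine (intervalIntegral.integral_congr fun x hx => ?_).trans
      intervalIntegral.integral_zero
    refine (intervalIntegral.integral_congr fun y hy => ?_).trans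
      intervalIntegral.integral_zero
    rw [Set.uIcc_of_le zero_le_one] at hx hy
    exact hcurl (x, y) ⟨hx, hy⟩
  have hs : ∀ r ∈ Set.Icc (0 : ℝ) 1,
      pathAction 0 1 (fun s => C (r, s)) = ∫ s in (0 : ℝ)..1, α (0, 1) (r, s) := by
    refine fun r hr => intervalIntegral.integral_congr fun s hs => ?_
    rw [Set.uIcc_of_le zero_le_one] at hs
    refine Finset.sum_congr rfl fun j _ => ?_
    have h := ((hx j (r, s) ⟨hr, hs⟩).differentiableAt (by norm_num)).hasFDerivAt
    rw [← (h.comp_hasDerivAt s ((hasDerivAt_const s r).prodMk (hasDerivAt_id s))).deriv]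
    rfl
  have hr : ∀ s ∈ Set.Icc (0 : ℝ) 1,
      pathAction 0 1 (fun r => C (r, s)) = ∫ r in (0 : ℝ)..1, α (1, 0) (r, s) := by
    refine fun s hs => intervalIntegral.integral_congr fun r hr => ?_
    rw [Set.uIcc_of_le zero_le_one] at hr
    refine Finset.sum_congr rfl fun j _ => ?_
    have h := ((hx j (r, s) ⟨hr, hs⟩).differentiableAt (by norm_num)).hasFDerivAt
    rw [← (h.comp_hasDerivAt r ((hasDerivAt_id r).prodMk (hasDerivAt_const r s))).deriv]
    rfl
  rw [hzero] at key
  simp only [intervalIntegral.integral_neg] at key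
  rw [hs 1 (by simp), hs 0 (by simp), hr 1 (by simp), hr 0 (by simp)]
  linarith

/-- Every point of a level set of a `C²` map which is close enough to a regular point `a` of this
level set is joined to `a` by a `C²` curve inside the level set. -/
theorem eventually_exists_curve_in_level_set {E F : Type*} [NormedAddCommGroup E]
    [NormedSpace ℝ E] [FiniteDimensional ℝ E] [NormedAddCommGroup F] [NormedSpace ℝ F]
    [FiniteDimensional ℝ F] {f : E → F} {a : E} (hf : ContDiffAt ℝ 2 f a)
    (hsurj : Function.Surjective (fderiv ℝ f a)) :
    ∀ᶠ x in 𝓝 a, f x = f a → ∃ γ : ℝ → E, γ 0 = a ∧ γ 1 = x ∧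
      ∀ r ∈ Set.Icc (0 : ℝ) 1, ContDiffAt ℝ 2 γ r ∧ ∀ᶠ r' in 𝓝 r, f (γ r') = f a := by
  have := FiniteDimensional.complete ℝ E
  have := FiniteDimensional.complete ℝ F
  have hrange : (fderiv ℝ f a).range = ⊤ := LinearMap.range_eq_top.2 hsurj
  let φ := (hf.hasStrictFDerivAt (by norm_num)).implicitFunctionDataOfComplemented f _ hrange
    (fderiv ℝ f a).ker_closedComplemented_of_finiteDimensional_range
  have hφ : ContDiffAt ℝ 2 φ.rightFun φ.pt := by
    exact (ContinuousLinearMap.contDiff _).contDiffAt.comp a (contDiffAt_id.sub contDiffAt_const)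
  have hsmooth : ContDiffAt ℝ 2 φ.implicitFunction.uncurry (φ.prodFun φ.pt) :=
    φ.contDiffAt_implicitFunction hf hφ (by norm_num)
  have hcurve : ContDiffAt ℝ 2 (φ.implicitFunction (f a)) (φ.rightFun a) :=
    hsmooth.comp (φ.rightFun a) (f := fun w => (f a, w)) (by fun_prop)
  have hlevel : ∀ᶠ w in 𝓝 (φ.rightFun a), f (φ.implicitFunction (f a) w) = f a :=
    φ.leftFun_implicitFunction.curry_nhds.self_of_nhds
  obtain ⟨ε, hε, hball⟩ := Metric.eventually_nhds_iff_ball.1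
    ((hcurve.eventually (by norm_num)).and hlevel)
  filter_upwards [φ.implicitFunction_apply_image,
    hφ.continuousAt.eventually (Metric.ball_mem_nhds _ hε)] with x hx hxε hfx
  let ℓ : ℝ → (fderiv ℝ f a).ker := AffineMap.lineMap (φ.rightFun a) (φ.rightFun x)
  have hℓ : ContDiff ℝ 2 ℓ := by
    simp only [ℓ]
    fun_prop
  have hℓmem : ∀ r ∈ Set.Icc (0 : ℝ) 1, ℓ r ∈ Metric.ball (φ.rightFun a) ε := fun r hr =>
    (convex_ball _ _).lineMap_mem (Metric.mem_ball_self hε) hxε hr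
  refine ⟨fun r => φ.implicitFunction (f a) (ℓ r), ?_, ?_, fun r hr => ⟨?_, ?_⟩⟩
  · simp only [ℓ, AffineMap.lineMap_apply_zero]
    exact φ.implicitFunction_apply_image.self_of_nhds
  · simp only [ℓ, AffineMap.lineMap_apply_one, ← hfx]
    exact hx
  · exact (hball _ (hℓmem r hr)).1.comp r hℓ.contDiffAt
  · filter_upwards [hℓ.continuous.continuousAt.eventually
      (Metric.isOpen_ball.mem_nhds (hℓmem r hr))] with r' hr'
    exact (hball _ hr').2

theorem pathAction_const {n : ℕ} (a b : ℝ) (ν : (Fin n → ℝ) × (Fin n → ℝ)) :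
    pathAction a b (fun _ => ν) = 0 := by
  simp [pathAction]

theorem pathAction_comp_mul_left {n : ℕ} (a b T : ℝ) (c : ℝ → (Fin n → ℝ) × (Fin n → ℝ)) :
    pathAction a b (fun s => c (T * s)) = pathAction (T * a) (T * b) c := by
  rw [pathAction, pathAction, ← intervalIntegral.smul_integral_comp_mul_left,
    ← intervalIntegral.integral_smul]
  refine intervalIntegral.integral_congr fun s _ => ?_
  simp only [smul_eq_mul, Finset.mul_sum]
  refine Finset.sum_congr rfl fun j _ => ?_
  rw [deriv_comp_mul_left T (fun u => (c u).1 j) s, smul_eq_mul]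
  ring

theorem contDiff_hamVF {n : ℕ} {f : (Fin n → ℝ) × (Fin n → ℝ) → ℝ} (hf : ContDiff ℝ 2 f) :
    ContDiff ℝ 1 (hamVF f) := by
  have h : ContDiff ℝ 1 (fderiv ℝ f) := hf.fderiv_right (by norm_num)
  exact (contDiff_pi.2 fun j => h.clm_apply contDiff_const).prodMk
    (contDiff_pi.2 fun j => (h.clm_apply contDiff_const).neg)

namespace IsJointFlow

variable {n k : ℕ} {q : Fin k → (Fin n → ℝ) × (Fin n → ℝ) → ℝ}
  {Φ : (Fin k → ℝ) → (Fin n → ℝ) × (Fin n → ℝ) → (Fin n → ℝ) × (Fin n → ℝ)}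

theorem contDiff_time (hΦ : IsJointFlow q Φ) (ν : (Fin n → ℝ) × (Fin n → ℝ)) :
    ContDiff ℝ 2 (fun t => Φ t ν) :=
  (contDiff_infty.1 hΦ.1 2).comp (contDiff_id.prodMk contDiff_const)

theorem fderiv_apply (hΦ : IsJointFlow q Φ) (t v : Fin k → ℝ) (ν : (Fin n → ℝ) × (Fin n → ℝ)) :
    fderiv ℝ (fun s => Φ s ν) t v = ∑ j, v j • hamVF (q j) (Φ t ν) := by
  conv_lhs => rw [pi_eq_sum_univ' v]
  simp only [map_sum, map_smul]
  refine Finset.sum_congr rfl fun j _ => ?_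
  rw [← hΦ.2.2 j t ν]

theorem sympl_fderiv_right (hΦ : IsJointFlow q Φ) (t v : Fin k → ℝ)
    (ν u : (Fin n → ℝ) × (Fin n → ℝ)) :
    sympl u (fderiv ℝ (fun s => Φ s ν) t v) = ∑ j, v j * fderiv ℝ (q j) (Φ t ν) u := by
  simp only [hΦ.fderiv_apply, sympl_sum_right, sympl_smul_right, sympl_hamVF]

theorem sympl_fderiv_fderiv (hΦ : IsJointFlow q Φ) (hcomm : ∀ i j ν, poisson (q i) (q j) ν = 0)
    (t u v : Fin k → ℝ) (ν : (Fin n → ℝ) × (Fin n → ℝ)) :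
    sympl (fderiv ℝ (fun s => Φ s ν) t u) (fderiv ℝ (fun s => Φ s ν) t v) = 0 := by
  rw [hΦ.sympl_fderiv_right]
  simp only [hΦ.fderiv_apply t u, map_sum, map_smul, ← sympl_hamVF, sympl_hamVF_hamVF, hcomm,
    smul_zero, Finset.sum_const_zero, mul_zero]

/-- The components of `q` are conserved along their joint flow. -/
theorem map_eq (hΦ : IsJointFlow q Φ) (hq : ∀ j, Differentiable ℝ (q j))
    (hcomm : ∀ i j ν, poisson (q i) (q j) ν = 0) (i : Fin k) (t : Fin k → ℝ)
    (ν : (Fin n → ℝ) × (Fin n → ℝ)) : q i (Φ t ν) = q i ν := by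
  have hd : Differentiable ℝ (fun s => Φ s ν) := (hΦ.contDiff_time ν).differentiable (by norm_num)
  have h0 : ∀ s, fderiv ℝ (fun s => q i (Φ s ν)) s = 0 := by
    intro s
    have h := (hq i (Φ s ν)).hasFDerivAt.comp s (hd s).hasFDerivAt
    ext v
    rw [show (fun s => q i (Φ s ν)) = q i ∘ fun s => Φ s ν from rfl, h.fderiv,
      ContinuousLinearMap.comp_apply, hΦ.fderiv_apply]
    simp only [map_sum, map_smul, ← sympl_hamVF, sympl_hamVF_hamVF, hcomm, smul_zero,
      Finset.sum_const_zero, zero_apply]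
  have h := is_const_of_fderiv_eq_zero (fun s => (hq i (Φ s ν)).comp s (hd s)) h0 t 0
  simpa [hΦ.2.1] using h

variable {S : Set ((Fin n → ℝ) × (Fin n → ℝ))}

/-- A time which fixes the point `ν` is a period of the orbit of `ν`. -/
theorem apply_add_smul_of_apply_eq (hΦ : IsJointFlow q Φ) (hq : ∀ j, ContDiff ℝ 2 (q j))
    (hScpt : IsCompact S) (hSinv : ∀ t, ∀ ν ∈ S, Φ t ν ∈ S) {ν : (Fin n → ℝ) × (Fin n → ℝ)}
    (hν : ν ∈ S) {T : Fin k → ℝ} (hT : Φ T ν = ν) (U : Fin k → ℝ) (r : ℝ) :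
    Φ (T + r • U) ν = Φ (r • U) ν := by
  have hX : ContDiff ℝ 1 (fun μ => ∑ j, U j • hamVF (q j) μ) :=
    ContDiff.sum fun j _ => (contDiff_hamVF (hq j)).const_smul (U j)
  obtain ⟨K, hK⟩ :=
    hX.locallyLipschitz.locallyLipschitzOn.exists_lipschitzOnWith_of_compact hScpt
  have hsol : ∀ (A : Fin k → ℝ) (r : ℝ), HasDerivAt (fun r : ℝ => Φ (A + r • U) ν)
      (∑ j, U j • hamVF (q j) (Φ (A + r • U) ν)) r := by
    intro A r
    have h := (((hΦ.contDiff_time ν).differentiable (by norm_num))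
      (A + r • U)).hasFDerivAt.comp_hasDerivAt r
      (((hasDerivAt_id r).smul_const U).const_add A)
    rw [one_smul, hΦ.fderiv_apply] at h
    exact h
  have h := ODE_solution_unique_univ (v := fun _ μ => ∑ j, U j • hamVF (q j) μ)
    (s := fun _ => S) (K := K) (t₀ := 0) (f := fun r : ℝ => Φ (T + r • U) ν)
    (g := fun r : ℝ => Φ (0 + r • U) ν) (fun _ => hK)
    (fun r => ⟨hsol T r, hSinv _ _ hν⟩) (fun r => ⟨hsol 0 r, hSinv _ _ hν⟩)
    (by simp [hT, hΦ.2.1])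
  simpa using congrFun h r

/-- The actions of straight paths issued from `ν` add up when the first one is a loop. -/
theorem pathAction_add (hΦ : IsJointFlow q Φ) (hq : ∀ j, ContDiff ℝ 2 (q j))
    (hcomm : ∀ i j ν, poisson (q i) (q j) ν = 0)
    (hScpt : IsCompact S) (hSinv : ∀ t, ∀ ν ∈ S, Φ t ν ∈ S) {ν : (Fin n → ℝ) × (Fin n → ℝ)}
    (hν : ν ∈ S) {T : Fin k → ℝ} (hT : Φ T ν = ν) (U : Fin k → ℝ) :
    pathAction 0 1 (fun s => Φ (s • (T + U)) ν) =
      pathAction 0 1 (fun s => Φ (s • T) ν) + pathAction 0 1 (fun s => Φ (s • U) ν) := by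
  let τ : ℝ × ℝ → Fin k → ℝ := fun p => p.2 • T + (p.1 * p.2) • U
  have hτ : ContDiff ℝ 2 τ := by fun_prop
  have h := pathAction_isotropic_square (C := fun p => Φ (τ p) ν)
    (fun p _ => ((hΦ.contDiff_time ν).comp hτ).contDiffAt) (fun p _ => by
      have hd := (((hΦ.contDiff_time ν).differentiable (by norm_num))
        (τ p)).hasFDerivAt.comp p ((hτ.differentiable (by norm_num)) p).hasFDerivAt
      rw [show (fun p => Φ (τ p) ν) = (fun t => Φ t ν) ∘ τ from rfl, hd.fderiv]
      exact hΦ.sympl_fderiv_fderiv hcomm _ _ _ _)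
  simp only [τ, one_mul, zero_mul, mul_one, mul_zero, one_smul, zero_smul, add_zero,
    ← smul_add, pathAction_const, sub_zero,
    hΦ.apply_add_smul_of_apply_eq hq hScpt hSinv hν hT] at h
  linarith

theorem pathAction_eq_sum (hΦ : IsJointFlow q Φ) (hq : ∀ j, ContDiff ℝ 2 (q j))
    (hcomm : ∀ i j ν, poisson (q i) (q j) ν = 0)
    (hScpt : IsCompact S) (hSinv : ∀ t, ∀ ν ∈ S, Φ t ν ∈ S) {ν : (Fin n → ℝ) × (Fin n → ℝ)}
    (hν : ν ∈ S) {T : Fin k → ℝ} (hT : ∀ j, Φ (Pi.single j (T j)) ν = ν) :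
    pathAction 0 1 (fun s => Φ (s • T) ν) =
      ∑ j, pathAction 0 (T j) (fun s => Φ (Pi.single j s) ν) := by
  have hsum : ∀ A : Finset (Fin k),
      pathAction 0 1 (fun s => Φ (s • ∑ j ∈ A, Pi.single j (T j)) ν) =
        ∑ j ∈ A, pathAction 0 1 (fun s => Φ (s • Pi.single j (T j)) ν) := by
    intro A
    induction A using Finset.induction_on with
    | empty => simp [pathAction_const]
    | insert i A hi ih =>
      rw [Finset.sum_insert hi, Finset.sum_insert hi, ← ih]
      exact hΦ.pathAction_add hq hcomm hScpt hSinv hν (hT i) _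
  have h := hsum Finset.univ
  rw [Finset.univ_sum_single] at h
  rw [h]
  refine Finset.sum_congr rfl fun j _ => ?_
  have h := pathAction_comp_mul_left 0 1 (T j) (fun s => Φ (Pi.single j s) ν)
  rw [mul_zero, mul_one] at h
  rw [← h]
  simp only [← Pi.single_smul, smul_eq_mul, mul_comm (T j)]

/-- The action of a period loop does not change when its base point moves along a `C²` curve inside
a level set of periodic points. -/
theorem pathAction_eq_of_curve (hΦ : IsJointFlow q Φ) (hq : ∀ j, ContDiff ℝ 2 (q j))
    (hcomm : ∀ i j ν, poisson (q i) (q j) ν = 0)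
    {E : Fin k → ℝ} {T : Fin k → ℝ} (hT : ∀ ν, (∀ j, q j ν = E j) → Φ T ν = ν)
    {γ : ℝ → (Fin n → ℝ) × (Fin n → ℝ)}
    (hγ : ∀ r ∈ Set.Icc (0 : ℝ) 1, ContDiffAt ℝ 2 γ r ∧ ∀ᶠ r' in 𝓝 r, ∀ j, q j (γ r') = E j) :
    pathAction 0 1 (fun s => Φ (s • T) (γ 0)) = pathAction 0 1 (fun s => Φ (s • T) (γ 1)) := by
  let C : ℝ × ℝ → (Fin n → ℝ) × (Fin n → ℝ) := fun p => Φ (p.2 • T) (γ p.1)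
  have hC : ∀ p ∈ Set.Icc (0 : ℝ) 1 ×ˢ Set.Icc (0 : ℝ) 1, ContDiffAt ℝ 2 C p := by
    intro p hp
    have h1 : ContDiffAt ℝ 2 (fun p : ℝ × ℝ => (p.2 • T, γ p.1)) p :=
      ContDiffAt.prodMk (by fun_prop) ((hγ p.1 hp.1).1.comp p contDiffAt_fst)
    exact (contDiff_infty.1 hΦ.1 2).contDiffAt.comp p h1
  have h := pathAction_isotropic_square hC (fun p hp => by
    have hCd := ((hC p hp).differentiableAt (by norm_num)).hasFDerivAt
    have hs : fderiv ℝ C p (0, 1) = fderiv ℝ (fun t => Φ t (γ p.1)) (p.2 • T) T := by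
      have h1 := hCd.comp_hasDerivAt p.2 ((hasDerivAt_const p.2 p.1).prodMk (hasDerivAt_id p.2))
      have h2 := ((hΦ.contDiff_time (γ p.1)).differentiable (by norm_num)
        (p.2 • T)).hasFDerivAt.comp_hasDerivAt p.2 ((hasDerivAt_id p.2).smul_const T)
      rw [one_smul] at h2
      exact h1.unique h2
    rw [hs, hΦ.sympl_fderiv_right]
    refine Finset.sum_eq_zero fun j _ => mul_eq_zero_of_right _ ?_
    have h1 := ((hq j).differentiable (by norm_num) (C p)).hasFDerivAt.comp_hasDerivAt p.1
      (hCd.comp_hasDerivAt p.1 ((hasDerivAt_id p.1).prodMk (hasDerivAt_const p.1 p.2)))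
    have h2 : HasDerivAt (q j ∘ C ∘ fun r => (r, p.2)) 0 p.1 := by
      refine (hasDerivAt_const p.1 (E j)).congr_of_eventuallyEq ?_
      filter_upwards [(hγ p.1 hp.1).2] with r hr
      exact (hΦ.map_eq (fun j => (hq j).differentiable (by norm_num)) hcomm j _ _).trans (hr j)
    exact h1.unique h2)
  have hend : pathAction 0 1 (fun r => C (r, 1)) = pathAction 0 1 (fun r => C (r, 0)) := by
    refine intervalIntegral.integral_congr fun r hr => ?_
    rw [Set.uIcc_of_le zero_le_one] at hr
    have heq : (fun r => C (r, 1)) =ᶠ[𝓝 r] fun r => C (r, 0) := by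
      filter_upwards [(hγ r hr).2] with r' hr'
      simp only [C, one_smul, zero_smul, hΦ.2.1, hT _ hr']
    refine Finset.sum_congr rfl fun j _ => ?_
    have hx : (fun r => (C (r, 1)).1 j) =ᶠ[𝓝 r] fun r => (C (r, 0)).1 j :=
      heq.fun_comp fun μ => μ.1 j
    rw [hx.deriv_eq, heq.self_of_nhds]
  rw [hend, sub_self, sub_eq_zero] at h
  exact h.symm

/-- The action of a period loop does not depend on its base point in a connected regular level
set. -/
theorem pathAction_eq_of_isPreconnected (hΦ : IsJointFlow q Φ) (hq : ∀ j, ContDiff ℝ 2 (q j))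
    (hcomm : ∀ i j ν, poisson (q i) (q j) ν = 0)
    {E : Fin k → ℝ} {T : Fin k → ℝ} (hT : ∀ ν, (∀ j, q j ν = E j) → Φ T ν = ν)
    (hconn : IsPreconnected {ν | ∀ j, q j ν = E j})
    (hreg : ∀ ν, (∀ j, q j ν = E j) →
      Function.Surjective (fun v => (fun j => fderiv ℝ (q j) ν v : Fin k → ℝ)))
    {ν₀ ν₁ : (Fin n → ℝ) × (Fin n → ℝ)} (h₀ : ∀ j, q j ν₀ = E j) (h₁ : ∀ j, q j ν₁ = E j) :
    pathAction 0 1 (fun s => Φ (s • T) ν₀) = pathAction 0 1 (fun s => Φ (s • T) ν₁) := by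
  have := Subtype.preconnectedSpace hconn
  let F : {ν | ∀ j, q j ν = E j} → ℝ := fun ν => pathAction 0 1 (fun s => Φ (s • T) ν)
  suffices hF : IsLocallyConstant F from
    hF.apply_eq_of_preconnectedSpace ⟨ν₀, h₀⟩ ⟨ν₁, h₁⟩
  refine (IsLocallyConstant.iff_eventually_eq F).2 fun ν => ?_
  have hQ : ContDiff ℝ 2 (fun μ j => q j μ) := contDiff_pi.2 hq
  have hQν : (fun j => q j ν) = E := funext ν.2
  have hsurj : Function.Surjective (fderiv ℝ (fun μ j => q j μ) (ν : _ × _)) := by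
    rw [fderiv_pi fun j => (hq j).differentiable (by norm_num) _]
    exact hreg ν ν.2
  filter_upwards [continuousAt_subtype_val.eventually
    (eventually_exists_curve_in_level_set hQ.contDiffAt hsurj)] with μ hμ
  obtain ⟨γ, hγ0, hγ1, hγ⟩ := hμ ((funext μ.2).trans hQν.symm)
  have h := hΦ.pathAction_eq_of_curve hq hcomm hT (γ := γ) fun r hr =>
    ⟨(hγ r hr).1, (hγ r hr).2.mono fun r' hr' => congrFun (hr'.trans hQν)⟩
  rw [hγ0, hγ1] at h
  exact h.symm

end IsJointFlow

end

open Real in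
/-- If every point of the nonempty, compact, connected regular level set
`Σ₀ = q⁻¹(E₀)` is periodic under the joint flow with period lattice containing
`(2πℤ)ᵏ`, then for all `ν₀, ν₁ ∈ Σ₀` and every period `T ∈ (2πℤ)ᵏ` the action of
the loop `s ∈ [0,1] ↦ Φ(sT, ν₁)` equals the sum over `j` of the actions of the
loops `s ∈ [0, T_j] ↦ Φ(s ε_j, ν₀)`; in particular it does not depend on the
base point in `Σ₀`. -/
theorem action_of_periodic_loops_base_point_independent {n k : ℕ}
    (q : Fin k → (Fin n → ℝ) × (Fin n → ℝ) → ℝ)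
    (hq : ∀ j, ContDiff ℝ (⊤ : ℕ∞) (q j))
    (hcomm : ∀ i j ν, poisson (q i) (q j) ν = 0)
    (Φ : (Fin k → ℝ) → (Fin n → ℝ) × (Fin n → ℝ) → (Fin n → ℝ) × (Fin n → ℝ))
    (hΦ : IsJointFlow q Φ)
    (E₀ : Fin k → ℝ)
    (S : Set ((Fin n → ℝ) × (Fin n → ℝ)))
    (hS : S = {ν | ∀ j, q j ν = E₀ j})
    (hSne : S.Nonempty) (hScpt : IsCompact S) (hSconn : IsConnected S)
    (hreg : ∀ ν ∈ S, Function.Surjective (fun v => (fun j => fderiv ℝ (q j) ν v : Fin k → ℝ)))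
    (hper : ∀ T : Fin k → ℝ, (∀ j, ∃ m : ℤ, T j = 2 * π * m) → ∀ ν ∈ S, Φ T ν = ν) :
    (∀ ν₀ ∈ S, ∀ ν₁ ∈ S, ∀ T : Fin k → ℝ, (∀ j, ∃ m : ℤ, T j = 2 * π * m) →
      pathAction 0 1 (fun s => Φ (s • T) ν₁) =
        ∑ j : Fin k, pathAction 0 (T j) (fun s => Φ (Pi.single j s) ν₀)) ∧
    (∀ ν₀ ∈ S, ∀ ν₁ ∈ S, ∀ T : Fin k → ℝ, (∀ j, ∃ m : ℤ, T j = 2 * π * m) →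
      pathAction 0 1 (fun s => Φ (s • T) ν₀) =
        pathAction 0 1 (fun s => Φ (s • T) ν₁)) := by
  have hq2 : ∀ j, ContDiff ℝ 2 (q j) := fun j => contDiff_infty.1 (hq j) 2
  subst hS
  have hSinv : ∀ t, ∀ ν ∈ {ν | ∀ j, q j ν = E₀ j}, Φ t ν ∈ {ν | ∀ j, q j ν = E₀ j} :=
    fun t ν hν j =>
      (hΦ.map_eq (fun j => (hq2 j).differentiable (by norm_num)) hcomm j t ν).trans (hν j)
  have hbase : ∀ ν₀ ∈ {ν | ∀ j, q j ν = E₀ j}, ∀ ν₁ ∈ {ν | ∀ j, q j ν = E₀ j},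
      ∀ T : Fin k → ℝ, (∀ j, ∃ m : ℤ, T j = 2 * π * m) →
      pathAction 0 1 (fun s => Φ (s • T) ν₀) = pathAction 0 1 (fun s => Φ (s • T) ν₁) :=
    fun ν₀ h₀ ν₁ h₁ T hT => hΦ.pathAction_eq_of_isPreconnected hq2 hcomm (hper T hT)
      hSconn.isPreconnected hreg h₀ h₁
  refine ⟨fun ν₀ h₀ ν₁ h₁ T hT => (hbase ν₁ h₁ ν₀ h₀ T hT).trans ?_, hbase⟩
  refine hΦ.pathAction_eq_sum hq2 hcomm hScpt hSinv h₀ fun j => hper _ (fun i => ?_) ν₀ h₀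
  obtain rfl | hij := eq_or_ne i j
  · simpa using hT i
  · exact ⟨0, by simp [hij]⟩
end
end

section
/- For every integer N ≥ 1 and every dimension k ≥ 1 there exists a continuous function φ_N : ℝᵏ → ℂ satisfying: (a) φ_N is the Fourier transform of a smooth compactly supported function, i.e. there exists a smooth compactly supported g : ℝᵏ → ℂ with φ_N = 𝓕 g; (b) there is a constant C > 0 with |φ_N(t) − 1| ≤ C‖t‖ᴺ for all t ∈ ℝᵏ (so in particular φ_N(0) = 1 and φ_N(t) = 1 + O(‖t‖ᴺ) as t → 0); and (c) there is a constant c > 0 such that for every m ∈ ℤᵏ with m ≠ 0 and every t ∈ ℝᵏ, |φ_N(t)| ≤ c‖t − m‖ᴺ. -/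
open MeasureTheory
open scoped FourierTransform

section TestFunctionTransforms

variable {V : Type*} [NormedAddCommGroup V] [InnerProductSpace ℝ V] [FiniteDimensional ℝ V]
  [MeasurableSpace V] [BorelSpace V]

/-- `φ` is the Fourier transform of a smooth compactly supported function. -/
def IsTestFourierTransform (φ : V → ℂ) : Prop :=
  ∃ g : V → ℂ, ContDiff ℝ (⊤ : ℕ∞) g ∧ HasCompactSupport g ∧ φ = 𝓕 g

namespace IsTestFourierTransform

lemma zero : IsTestFourierTransform (0 : V → ℂ) :=
  ⟨0, contDiff_const, HasCompactSupport.zero, by ext t; simp [Real.fourier_eq]⟩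

lemma add {φ ψ : V → ℂ} (hφ : IsTestFourierTransform φ) (hψ : IsTestFourierTransform ψ) :
    IsTestFourierTransform (φ + ψ) := by
  obtain ⟨g, hg, hgc, rfl⟩ := hφ
  obtain ⟨h, hh, hhc, rfl⟩ := hψ
  refine ⟨g + h, hg.add hh, hgc.add hhc, ?_⟩
  exact congrArg DFunLike.coe
    (FourierTransform.fourier_add (hgc.toSchwartzMap hg) (hhc.toSchwartzMap hh)).symm

lemma neg {φ : V → ℂ} (hφ : IsTestFourierTransform φ) : IsTestFourierTransform (-φ) := by
  obtain ⟨g, hg, hgc, rfl⟩ := hφ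
  refine ⟨-g, hg.neg, hgc.neg, ?_⟩
  ext t
  simp [Real.fourier_eq, integral_neg]

/-- Smoothing an integrable compactly supported function by a test function. -/
lemma fourier_mul {g : V → ℂ} (hg : Integrable g) (hgc : HasCompactSupport g)
    {ψ : V → ℂ} (hψ : IsTestFourierTransform ψ) : IsTestFourierTransform (𝓕 g * ψ) := by
  obtain ⟨h, hh, hhc, rfl⟩ := hψ
  refine ⟨convolution g h (ContinuousLinearMap.mul ℝ ℂ) volume,
    hhc.contDiff_convolution_right _ hg.locallyIntegrable hh, hgc.convolution _ hhc, ?_⟩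
  have hmul : convolution g h (ContinuousLinearMap.mul ℝ ℂ) volume =
      convolution g h (ContinuousLinearMap.mul ℂ ℂ) volume := by
    ext x
    simp only [convolution_def, ContinuousLinearMap.mul_apply']
  rw [hmul]
  ext t
  rw [Real.fourier_mul_convolution_eq hg (hh.continuous.integrable_of_hasCompactSupport hhc),
    Pi.mul_apply]

lemma mul {φ ψ : V → ℂ} (hφ : IsTestFourierTransform φ) (hψ : IsTestFourierTransform ψ) :
    IsTestFourierTransform (φ * ψ) := by
  obtain ⟨g, hg, hgc, rfl⟩ := hφ
  exact fourier_mul (hg.continuous.integrable_of_hasCompactSupport hgc) hgc hψ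

lemma pow {φ : V → ℂ} (hφ : IsTestFourierTransform φ) {n : ℕ} (hn : 1 ≤ n) :
    IsTestFourierTransform (φ ^ n) := by
  induction n, hn using Nat.le_induction with
  | base => simpa using hφ
  | succ n _ ih => exact pow_succ φ n ▸ ih.mul hφ

lemma one_sub_one_sub_pow {φ : V → ℂ} (hφ : IsTestFourierTransform φ) (n : ℕ) :
    IsTestFourierTransform (1 - (1 - φ) ^ n) := by
  induction n with
  | zero => simpa using zero
  | succ n ih =>
    have : 1 - (1 - φ) ^ (n + 1) = (1 - (1 - φ) ^ n) + φ + -(φ * (1 - (1 - φ) ^ n)) := by ring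
    rw [this]
    exact (ih.add hφ).add (hφ.mul ih).neg

lemma exists_schwartzMap {φ : V → ℂ} (hφ : IsTestFourierTransform φ) :
    ∃ f : SchwartzMap V ℂ, ⇑f = φ := by
  obtain ⟨g, hg, hgc, rfl⟩ := hφ
  exact ⟨𝓕 (hgc.toSchwartzMap hg), rfl⟩

lemma continuous {φ : V → ℂ} (hφ : IsTestFourierTransform φ) : Continuous φ := by
  obtain ⟨f, rfl⟩ := hφ.exists_schwartzMap
  exact f.continuous

lemma bounded {φ : V → ℂ} (hφ : IsTestFourierTransform φ) : ∃ M : ℝ, ∀ t, ‖φ t‖ ≤ M := by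
  obtain ⟨f, rfl⟩ := hφ.exists_schwartzMap
  exact ⟨_, f.norm_le_seminorm ℝ⟩

lemma lipschitz {φ : V → ℂ} (hφ : IsTestFourierTransform φ) :
    ∃ L > (0 : ℝ), ∀ s t, ‖φ t - φ s‖ ≤ L * ‖t - s‖ := by
  obtain ⟨f, rfl⟩ := hφ.exists_schwartzMap
  set L := SchwartzMap.seminorm ℝ 0 0 (SchwartzMap.fderivCLM ℝ V ℂ f)
  refine ⟨L + 1, by positivity, fun s t => ?_⟩
  refine convex_univ.norm_image_sub_le_of_norm_fderiv_le (𝕜 := ℝ)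
    (fun x _ => f.differentiableAt) (fun x _ => ?_) (Set.mem_univ s) (Set.mem_univ t)
  have := SchwartzMap.norm_le_seminorm ℝ (SchwartzMap.fderivCLM ℝ V ℂ f) x
  rw [SchwartzMap.fderivCLM_apply] at this
  linarith

variable (V) in
lemma exists_apply_zero_eq_one : ∃ φ : V → ℂ, IsTestFourierTransform φ ∧ φ 0 = 1 := by
  let ρ : ContDiffBump (0 : V) := ⟨1, 2, one_pos, one_lt_two⟩
  refine ⟨_, ⟨fun x => (ρ.normed volume x : ℂ), ?_, ?_, rfl⟩, ?_⟩
  · exact Complex.ofRealCLM.contDiff.comp ρ.contDiff_normed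
  · exact ρ.hasCompactSupport_normed.comp_left Complex.ofReal_zero
  · simp [Real.fourier_eq, integral_complex_ofReal, ρ.integral_normed]

end IsTestFourierTransform

end TestFunctionTransforms

section UnitCube

variable {ι : Type*} [Fintype ι]

/-- The indicator function of the unit cube `(0, 1]ⁿ`. -/
noncomputable def unitCubeIndicator (ι : Type*) [Fintype ι] (x : EuclideanSpace ℝ ι) : ℂ :=
  ∏ i, (Set.Ioc (0 : ℝ) 1).indicator 1 (x i)

lemma hasCompactSupport_unitCubeIndicator : HasCompactSupport (unitCubeIndicator ι) := by
  have hK : IsCompact ((EuclideanSpace.equiv ι ℝ).symm '' Set.univ.pi fun _ => Set.Icc 0 1) :=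
    (isCompact_univ_pi fun _ => isCompact_Icc).image (EuclideanSpace.equiv ι ℝ).symm.continuous
  refine HasCompactSupport.intro hK fun x hx => ?_
  by_contra h
  refine hx ⟨EuclideanSpace.equiv ι ℝ x, fun i _ => ?_, by simp⟩
  have := Finset.prod_ne_zero_iff.1 h i (Finset.mem_univ i)
  exact Set.Ioc_subset_Icc_self (Set.mem_of_indicator_ne_zero this)

lemma integrable_unitCubeIndicator : Integrable (unitCubeIndicator ι) := by
  have h : Integrable fun x : ι → ℝ => ∏ i, (Set.Ioc (0 : ℝ) 1).indicator (1 : ℝ → ℂ) (x i) :=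
    Integrable.fintype_prod fun _ =>
      (integrable_indicator_iff measurableSet_Ioc).2 (integrableOn_const (by simp))
  exact (PiLp.volume_preserving_ofLp ι).integrable_comp_of_integrable h

/-- Orthogonality of characters on the unit interval. -/
lemma integral_fourierChar_mul_indicator (n : ℤ) :
    ∫ x : ℝ, (Real.fourierChar (-(x * n)) : ℂ) * (Set.Ioc (0 : ℝ) 1).indicator 1 x =
      if n = 0 then 1 else 0 := by
  have h : ∀ x : ℝ, (Real.fourierChar (-(x * n)) : ℂ) * (Set.Ioc (0 : ℝ) 1).indicator 1 x =
      (Set.Ioc (0 : ℝ) 1).indicator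
        (fun x : ℝ => Complex.exp (-(2 * Real.pi * Complex.I * n) * x)) x := by
    intro x
    by_cases hx : x ∈ Set.Ioc (0 : ℝ) 1
    · simp only [Set.indicator_of_mem hx, Real.fourierChar_apply, Pi.one_apply, mul_one]
      push_cast
      ring_nf
    · simp [Set.indicator_of_notMem hx]
  simp_rw [h]
  rw [integral_indicator measurableSet_Ioc, ← intervalIntegral.integral_of_le zero_le_one]
  split_ifs with hn
  · simp [hn]
  · have hc : -(2 * Real.pi * Complex.I * n) ≠ 0 := by
      simp [hn, Real.pi_ne_zero]
    rw [integral_exp_mul_complex hc]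
    have : Complex.exp (2 * Real.pi * Complex.I * n) = 1 :=
      Complex.exp_eq_one_iff.2 ⟨n, by ring⟩
    simp [Complex.exp_neg, this]

lemma fourier_unitCubeIndicator (m : ι → ℤ) :
    𝓕 (unitCubeIndicator ι) (WithLp.toLp 2 fun i => (m i : ℝ)) = if m = 0 then 1 else 0 := by
  have h : ∀ x : EuclideanSpace ℝ ι,
      Real.fourierChar (-inner ℝ x (WithLp.toLp 2 fun i => (m i : ℝ))) • unitCubeIndicator ι x =
        ∏ i, ((Real.fourierChar (-(x i * m i)) : ℂ) * (Set.Ioc (0 : ℝ) 1).indicator 1 (x i)) := by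
    intro x
    rw [Finset.prod_mul_distrib, Circle.smul_def, smul_eq_mul, unitCubeIndicator]
    congr 1
    simp only [Real.fourierChar_apply, ← Complex.exp_sum, PiLp.inner_apply]
    congr 1
    simp [Finset.mul_sum, mul_comm]
  rw [Real.fourier_eq]
  simp_rw [h]
  rw [(PiLp.volume_preserving_ofLp ι).integral_comp
    (MeasurableEquiv.toLp 2 (ι → ℝ)).symm.measurableEmbedding
    (fun y : ι → ℝ => ∏ i, ((Real.fourierChar (-(y i * m i)) : ℂ) *
      (Set.Ioc (0 : ℝ) 1).indicator 1 (y i)))]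
  rw [integral_fintype_prod_volume_eq_prod (fun i (y : ℝ) =>
    (Real.fourierChar (-(y * m i)) : ℂ) * (Set.Ioc (0 : ℝ) 1).indicator 1 y)]
  simp_rw [integral_fourierChar_mul_indicator]
  simp [Finset.prod_ite_zero, funext_iff]

/-- There is a Fourier transform of a test function interpolating `δ₀` on the integer lattice. -/
lemma exists_isTestFourierTransform_lattice_delta (ι : Type*) [Fintype ι] :
    ∃ f : EuclideanSpace ℝ ι → ℂ, IsTestFourierTransform f ∧ f 0 = 1 ∧
      ∀ m : ι → ℤ, m ≠ 0 → f (WithLp.toLp 2 fun i => (m i : ℝ)) = 0 := by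
  obtain ⟨ψ, hψ, hψ0⟩ :=
    IsTestFourierTransform.exists_apply_zero_eq_one (EuclideanSpace ℝ ι)
  refine ⟨_, hψ.fourier_mul integrable_unitCubeIndicator hasCompactSupport_unitCubeIndicator,
    ?_, fun m hm => ?_⟩
  · have h0 : (WithLp.toLp 2 fun i : ι => (((0 : ι → ℤ) i : ℤ) : ℝ)) = 0 := by ext; simp
    have := fourier_unitCubeIndicator (0 : ι → ℤ)
    rw [h0, if_pos rfl] at this
    simp [hψ0, this]
  · simp [fourier_unitCubeIndicator, hm]

end UnitCube

/-- For every `N ≥ 1` and `k ≥ 1` there is a continuous cutoff `φ_N : ℝᵏ → ℂ`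
which is the Fourier transform of a smooth compactly supported function,
satisfies `φ_N(t) = 1 + O(‖t‖ᴺ)` near `0` (globally, `|φ_N(t) − 1| ≤ C‖t‖ᴺ`),
and is `≤ c‖t − m‖ᴺ` near every nonzero lattice point `m ∈ ℤᵏ`. -/
theorem exists_lattice_cutoff (N k : ℕ) (hN : 1 ≤ N) (hk : 1 ≤ k) :
    ∃ φ : EuclideanSpace ℝ (Fin k) → ℂ,
      Continuous φ ∧
      (∃ g : EuclideanSpace ℝ (Fin k) → ℂ,
        ContDiff ℝ (⊤ : ℕ∞) g ∧ HasCompactSupport g ∧ φ = 𝓕 g) ∧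
      (∃ C > (0 : ℝ), ∀ t, ‖φ t - 1‖ ≤ C * ‖t‖ ^ N) ∧
      (∃ c > (0 : ℝ), ∀ m : Fin k → ℤ, m ≠ 0 → ∀ t,
        ‖φ t‖ ≤ c * ‖t - (WithLp.equiv 2 (Fin k → ℝ)).symm (fun i => (m i : ℝ))‖ ^ N) := by
  obtain ⟨f, hf, hf0, hfm⟩ := exists_isTestFourierTransform_lattice_delta (Fin k)
  have hF := hf.pow hN
  have hφ := hF.one_sub_one_sub_pow N
  obtain ⟨L, hL, hfL⟩ := hf.lipschitz
  obtain ⟨K, hK, hFK⟩ := hF.lipschitz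
  obtain ⟨M, hM⟩ := hF.bounded
  have hM0 : 0 ≤ M := (norm_nonneg _).trans (hM 0)
  refine ⟨_, hφ.continuous, hφ, ⟨K ^ N, by positivity, fun t => ?_⟩,
    ⟨L ^ N * ∑ i ∈ Finset.range N, (1 + M) ^ i, ?_, fun m hm t => ?_⟩⟩
  · have h : ‖1 - f t ^ N‖ ≤ K * ‖t‖ := by
      simpa [hf0, norm_sub_rev] using hFK 0 t
    calc ‖(1 - (1 - f ^ N) ^ N) t - 1‖ = ‖1 - f t ^ N‖ ^ N := by simp
      _ ≤ (K * ‖t‖) ^ N := by gcongr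
      _ = K ^ N * ‖t‖ ^ N := mul_pow _ _ _
  · have : 0 < ∑ i ∈ Finset.range N, (1 + M) ^ i :=
      Finset.sum_pos (fun i _ => by positivity) (by simp; omega)
    positivity
  · have h1 : ‖f t‖ ≤ L * ‖t - WithLp.toLp 2 fun i => (m i : ℝ)‖ := by
      simpa [hfm m hm] using hfL (WithLp.toLp 2 fun i => (m i : ℝ)) t
    have h2 : ‖1 - f t ^ N‖ ≤ 1 + M :=
      (norm_sub_le _ _).trans (by simpa using hM t)
    have h3 : 1 - (1 - f t ^ N) ^ N = f t ^ N * ∑ i ∈ Finset.range N, (1 - f t ^ N) ^ i := by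
      simpa using (mul_neg_geom_sum (1 - f t ^ N) N).symm
    change ‖1 - (1 - f t ^ N) ^ N‖ ≤ _ * ‖t - WithLp.toLp 2 fun i => (m i : ℝ)‖ ^ N
    rw [h3, norm_mul, norm_pow, mul_right_comm, ← mul_pow]
    gcongr
    exact (norm_sum_le _ _).trans (Finset.sum_le_sum fun i _ => by rw [norm_pow]; gcongr)
end
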